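/- Let (X,w) be a Euclidean 6-design in ℝ^22 supported by exactly two concentric spheres of positive radii r1, r2 centered at the origin, with fibers X1 and X2, |X| = 2300 and |X1| = 275. Then the set A(X1,X2) = { (x·y)/(r1 r2) : x ∈ X1, y ∈ X2 } of normalized inner products between points of X1 and points of X2 equals {1/√11, −1/(4√11), −3/(2√11)}. -/

import Mathlib

open MeasureTheory Metric MvPolynomial
open scoped RealInnerProductSpace Classical

/-- Average of a polynomial over the sphere of radius `r` centered at the origin in `ℝⁿ`,
with respect to the (rotation-invariant, normalized) surface measure. -/
noncomputable def sphereAvg (n : ℕ) (r : ℝ) (f : MvPolynomial (Fin n) ℝ) : ℝ :=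
  ⨍ u : sphere (0 : EuclideanSpace ℝ (Fin n)) 1,
    eval (fun i => r * (u : EuclideanSpace ℝ (Fin n)) i) f
    ∂((volume : Measure (EuclideanSpace ℝ (Fin n))).toSphere)

/-- `(X₁ ∪ X₂, w)` is a Euclidean `t`-design of `ℝ²²` supported by the two concentric spheres
of radii `r₁` and `r₂` centered at the origin, with fibers `X₁ ⊆ S(0,r₁)` and `X₂ ⊆ S(0,r₂)`. -/
def IsEuclideanDesignTwoSpheres (t : ℕ) (X₁ X₂ : Finset (EuclideanSpace ℝ (Fin 22)))
    (w : EuclideanSpace ℝ (Fin 22) → ℝ) (r₁ r₂ : ℝ) : Prop :=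
  ∀ f : MvPolynomial (Fin 22) ℝ, f.totalDegree ≤ t →
    (∑ x ∈ X₁, w x) * sphereAvg 22 r₁ f + (∑ x ∈ X₂, w x) * sphereAvg 22 r₂ f
      = ∑ x ∈ X₁ ∪ X₂, w x * eval (x : Fin 22 → ℝ) f


/-- The mean of a function over the unit sphere of `ℝⁿ`. -/
noncomputable def sphereMean (n : ℕ) (F : EuclideanSpace ℝ (Fin n) → ℝ) : ℝ :=
  ⨍ u : sphere (0 : EuclideanSpace ℝ (Fin n)) 1, F u
    ∂((volume : Measure (EuclideanSpace ℝ (Fin n))).toSphere)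

section SphereMean

variable {n : ℕ}

/-- A linear isometry preserves the surface measure of the unit sphere. -/
theorem exists_measurePreserving_sphere
    (g : EuclideanSpace ℝ (Fin n) ≃ₗᵢ[ℝ] EuclideanSpace ℝ (Fin n)) :
    ∃ e : sphere (0 : EuclideanSpace ℝ (Fin n)) 1 ≃ₜ sphere (0 : EuclideanSpace ℝ (Fin n)) 1,
      (∀ u, (e u : EuclideanSpace ℝ (Fin n)) = g u) ∧
      MeasurePreserving e (volume : Measure (EuclideanSpace ℝ (Fin n))).toSphere
        (volume : Measure (EuclideanSpace ℝ (Fin n))).toSphere := by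
  let e : sphere (0 : EuclideanSpace ℝ (Fin n)) 1 ≃ₜ sphere (0 : EuclideanSpace ℝ (Fin n)) 1 :=
    { toFun := fun u => ⟨g u, by simp⟩
      invFun := fun u => ⟨g.symm u, by simp⟩
      left_inv := fun u => by simp
      right_inv := fun u => by simp
      continuous_toFun := by fun_prop
      continuous_invFun := by fun_prop }
  have he : ∀ u, (e u : EuclideanSpace ℝ (Fin n)) = g u := fun u => rfl
  refine ⟨e, he, e.continuous.measurable, Measure.ext fun s hs => ?_⟩
  rw [Measure.map_apply e.continuous.measurable hs,
    Measure.toSphere_apply' _ (e.continuous.measurable hs), Measure.toSphere_apply' _ hs]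
  congr 1
  have hg : MeasurePreserving g.toHomeomorph.toMeasurableEquiv := g.measurePreserving
  refine Eq.trans (congrArg _ ?_) (hg.measure_preimage_equiv _)
  ext x
  simp only [Set.mem_smul, Set.mem_image, Set.mem_preimage]
  constructor
  · rintro ⟨t, ht, y, ⟨u, hu, rfl⟩, rfl⟩
    exact ⟨t, ht, g u, ⟨e u, hu, rfl⟩, (map_smul g t (u : EuclideanSpace ℝ (Fin n))).symm⟩
  · rintro ⟨t, ht, y, ⟨u, hu, rfl⟩, hx⟩
    refine ⟨t, ht, _, ⟨e.symm u, by simpa using hu, rfl⟩, ?_⟩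
    apply g.injective
    rw [map_smul, ← he, e.apply_symm_apply]
    exact hx

theorem sphereMean_comp (g : EuclideanSpace ℝ (Fin n) ≃ₗᵢ[ℝ] EuclideanSpace ℝ (Fin n))
    (F : EuclideanSpace ℝ (Fin n) → ℝ) : sphereMean n (fun x => F (g x)) = sphereMean n F := by
  obtain ⟨e, he, hm⟩ := exists_measurePreserving_sphere g
  unfold sphereMean
  rw [average_eq, average_eq,
    ← hm.integral_comp e.measurableEmbedding fun u => F (u : EuclideanSpace ℝ (Fin n))]
  simp only [he]

theorem integrable_sphere {F : EuclideanSpace ℝ (Fin n) → ℝ} (hF : Continuous F) :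
    Integrable (fun u : sphere (0 : EuclideanSpace ℝ (Fin n)) 1 => F u)
      (volume : Measure (EuclideanSpace ℝ (Fin n))).toSphere :=
  (hF.comp continuous_subtype_val).integrable_of_hasCompactSupport
    (HasCompactSupport.of_compactSpace _)

theorem sphereMean_add {F G : EuclideanSpace ℝ (Fin n) → ℝ} (hF : Continuous F)
    (hG : Continuous G) :
    sphereMean n (fun x => F x + G x) = sphereMean n F + sphereMean n G := by
  unfold sphereMean
  rw [average_eq, average_eq, average_eq,
    integral_add (integrable_sphere hF) (integrable_sphere hG), smul_add]

theorem sphereMean_const_mul (c : ℝ) (F : EuclideanSpace ℝ (Fin n) → ℝ) :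
    sphereMean n (fun x => c * F x) = c * sphereMean n F := by
  unfold sphereMean
  rw [average_eq, average_eq, integral_const_mul, smul_eq_mul, smul_eq_mul, mul_left_comm]

theorem sphereMean_sum {ι : Type*} (s : Finset ι) {F : ι → EuclideanSpace ℝ (Fin n) → ℝ}
    (hF : ∀ i, Continuous (F i)) :
    sphereMean n (fun x => ∑ i ∈ s, F i x) = ∑ i ∈ s, sphereMean n (F i) := by
  unfold sphereMean
  simp only [average_eq, ← Finset.smul_sum]
  rw [integral_finsetSum s fun i _ => integrable_sphere (hF i)]

theorem sphereMean_congr {F G : EuclideanSpace ℝ (Fin n) → ℝ} (h : ∀ x, ‖x‖ = 1 → F x = G x) :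
    sphereMean n F = sphereMean n G := by
  unfold sphereMean
  congr 1
  funext u
  exact h u (by simp)

theorem sphereMean_const [NeZero n] (c : ℝ) : sphereMean n (fun _ => c) = c := by
  have : NeZero (volume : Measure (EuclideanSpace ℝ (Fin n))).toSphere :=
    ⟨Measure.toSphere_ne_zero _⟩
  exact average_const _ _


theorem sphereMean_linearCombination {ι : Type*} (s : Finset ι) (c : ι → ℝ)
    {F : ι → EuclideanSpace ℝ (Fin n) → ℝ} (hF : ∀ i, Continuous (F i)) :
    sphereMean n (fun x => ∑ i ∈ s, c i * F i x) = ∑ i ∈ s, c i * sphereMean n (F i) := by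
  rw [sphereMean_sum s (F := fun i x => c i * F i x) fun i => continuous_const.mul (hF i)]
  simp only [sphereMean_const_mul]

/-- The mean of `⟪a, x⟫ ^ k` over the unit sphere depends on `a` only through its norm. -/
theorem sphereMean_inner_pow_congr (k : ℕ) {a b : EuclideanSpace ℝ (Fin n)} (h : ‖a‖ = ‖b‖) :
    sphereMean n (fun x => ⟪a, x⟫ ^ k) = sphereMean n (fun x => ⟪b, x⟫ ^ k) := by
  rw [← sphereMean_comp (Submodule.reflection (ℝ ∙ (a - b))ᗮ) fun x => ⟪b, x⟫ ^ k]
  congr 1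
  funext x
  have hab := LinearIsometryEquiv.inner_map_map (Submodule.reflection (ℝ ∙ (a - b))ᗮ) a x
  rw [Submodule.reflection_sub h] at hab
  rw [hab]

theorem exists_sphereMean_inner_pow [NeZero n] (k : ℕ) :
    ∃ m : ℝ, ∀ a : EuclideanSpace ℝ (Fin n),
      sphereMean n (fun x => ⟪a, x⟫ ^ (2 * k)) = m * ⟪a, a⟫ ^ k := by
  refine ⟨sphereMean n fun x => ⟪EuclideanSpace.single (0 : Fin n) (1 : ℝ), x⟫ ^ (2 * k),
    fun a => ?_⟩
  rw [sphereMean_inner_pow_congr (b := ‖a‖ • EuclideanSpace.single (0 : Fin n) (1 : ℝ)) (2 * k)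
    (by simp [norm_smul])]
  simp only [real_inner_smul_left, mul_pow, sphereMean_const_mul, real_inner_self_eq_norm_sq,
    pow_mul]
  ring

theorem sum_inner_single_sq (x : EuclideanSpace ℝ (Fin n)) :
    ∑ i, ⟪EuclideanSpace.single i (1 : ℝ), x⟫ ^ 2 = ⟪x, x⟫ := by
  simp [-inner_self_eq_norm_sq_to_K, PiLp.inner_apply, sq]

/-- Summing over an orthonormal basis reduces a moment to one of lower degree. -/
theorem sum_sphereMean_mul_single_sq {F : EuclideanSpace ℝ (Fin n) → ℝ} (hF : Continuous F) :
    ∑ i, sphereMean n (fun x => F x * ⟪EuclideanSpace.single i (1 : ℝ), x⟫ ^ 2)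
      = sphereMean n F := by
  rw [← sphereMean_sum _ fun i => by fun_prop]
  refine sphereMean_congr fun x hx => ?_
  rw [← Finset.mul_sum, sum_inner_single_sq, real_inner_self_eq_norm_sq, hx]
  ring

theorem sphereMean_inner_mul_inner [NeZero n] (a b : EuclideanSpace ℝ (Fin n)) :
    sphereMean n (fun x => ⟪a, x⟫ * ⟪b, x⟫) = ⟪a, b⟫ / n := by
  obtain ⟨m, hm⟩ := exists_sphereMean_inner_pow (n := n) 1
  have key : ∀ a b : EuclideanSpace ℝ (Fin n),
      sphereMean n (fun x => ⟪a, x⟫ * ⟪b, x⟫) = m * ⟪a, b⟫ := by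
    intro a b
    have h : (fun x : EuclideanSpace ℝ (Fin n) => ⟪a, x⟫ * ⟪b, x⟫) =
        fun x => ∑ i, ![(1 / 4 : ℝ), -(1 / 4)] i * ⟪![a + b, a - b] i, x⟫ ^ (2 * 1) := by
      funext x
      simp [Fin.sum_univ_succ, inner_add_left, inner_sub_left]
      ring
    rw [h, sphereMean_linearCombination _ _ fun i => by fun_prop]
    simp [-inner_self_eq_norm_sq_to_K, Fin.sum_univ_succ, inner_add_left,
      inner_sub_left, inner_add_right, inner_sub_right,
      -mul_one, hm, real_inner_comm a b]
    ring
  have hs := sum_sphereMean_mul_single_sq (n := n) (F := fun _ => 1) continuous_const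
  have hn : (n : ℝ) ≠ 0 := by exact_mod_cast NeZero.ne n
  simp only [one_mul, sq, key, sphereMean_const] at hs
  simp at hs
  rw [key]
  field_simp
  linear_combination ⟪a, b⟫ * hs

theorem sphereMean_inner_sq [NeZero n] (a : EuclideanSpace ℝ (Fin n)) :
    sphereMean n (fun x => ⟪a, x⟫ ^ 2) = ⟪a, a⟫ / n := by
  simp only [sq, sphereMean_inner_mul_inner]

theorem sphereMean_quartic [NeZero n] (a b : EuclideanSpace ℝ (Fin n)) :
    sphereMean n (fun x => ⟪a, x⟫ ^ 2 * ⟪b, x⟫ ^ 2)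
        = (⟪a, a⟫ * ⟪b, b⟫ + 2 * ⟪a, b⟫ ^ 2) / (n * (n + 2)) ∧
      sphereMean n (fun x => ⟪a, x⟫ * ⟪b, x⟫ ^ 3)
        = 3 * ⟪b, b⟫ * ⟪a, b⟫ / (n * (n + 2)) := by
  obtain ⟨m, hm⟩ := exists_sphereMean_inner_pow (n := n) 2
  have key : ∀ a b : EuclideanSpace ℝ (Fin n),
      sphereMean n (fun x => ⟪a, x⟫ ^ 2 * ⟪b, x⟫ ^ 2)
        = m / 3 * (⟪a, a⟫ * ⟪b, b⟫ + 2 * ⟪a, b⟫ ^ 2) := by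
    intro a b
    have h : (fun x : EuclideanSpace ℝ (Fin n) => ⟪a, x⟫ ^ 2 * ⟪b, x⟫ ^ 2) =
        fun x => ∑ i, ![(1 / 12 : ℝ), 1 / 12, -(1 / 6), -(1 / 6)] i *
          ⟪![a + b, a - b, a, b] i, x⟫ ^ (2 * 2) := by
      funext x
      simp [Fin.sum_univ_succ, inner_add_left, inner_sub_left]
      ring
    rw [h, sphereMean_linearCombination _ _ fun i => by fun_prop]
    simp only [hm]
    simp [-inner_self_eq_norm_sq_to_K, Fin.sum_univ_succ, inner_add_left,
      inner_sub_left, inner_add_right, inner_sub_right,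
      real_inner_comm a b]
    ring
  have hn : (n : ℝ) ≠ 0 := by exact_mod_cast NeZero.ne n
  have hn2 : (n : ℝ) + 2 ≠ 0 := by positivity
  have hm4 : m = 3 / (n * (n + 2)) := by
    have hs := sum_sphereMean_mul_single_sq (n := n)
      (F := fun x => ⟪EuclideanSpace.single (0 : Fin n) (1 : ℝ), x⟫ ^ 2) (by fun_prop)
    simp only [key, sphereMean_inner_sq, ← Finset.mul_sum, Finset.sum_add_distrib] at hs
    have h2 : ∑ i, ⟪EuclideanSpace.single (0 : Fin n) (1 : ℝ), EuclideanSpace.single i (1 : ℝ)⟫ ^ 2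
        = 1 := by
      simp only [real_inner_comm _ (EuclideanSpace.single (0 : Fin n) (1 : ℝ)),
        sum_inner_single_sq]
      simp
    rw [h2] at hs
    simp at hs
    field_simp at hs ⊢
    linear_combination hs
  refine ⟨by rw [key, hm4]; field_simp, ?_⟩
  have h : (fun x : EuclideanSpace ℝ (Fin n) => ⟪a, x⟫ * ⟪b, x⟫ ^ 3) =
      fun x => ∑ i, ![(1 / 48 : ℝ), -(1 / 48), -(1 / 24), 1 / 24] i *
        ⟪![a + (2 : ℝ) • b, a - (2 : ℝ) • b, a + b, a - b] i, x⟫ ^ (2 * 2) := by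
    funext x
    simp [Fin.sum_univ_succ, inner_add_left, inner_sub_left, inner_smul_left]
    ring
  rw [h, sphereMean_linearCombination _ _ fun i => by fun_prop]
  simp only [hm]
  simp [-inner_self_eq_norm_sq_to_K, Fin.sum_univ_succ, inner_add_left,
      inner_sub_left, inner_add_right, inner_sub_right,
    inner_smul_left, inner_smul_right, real_inner_comm a b, hm4]
  field_simp
  ring

theorem sphereMean_sextic [NeZero n] (a b : EuclideanSpace ℝ (Fin n)) :
    sphereMean n (fun x => ⟪a, x⟫ ^ 3 * ⟪b, x⟫ ^ 3)
        = (9 * ⟪a, a⟫ * ⟪b, b⟫ * ⟪a, b⟫ + 6 * ⟪a, b⟫ ^ 3) / (n * (n + 2) * (n + 4)) := by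
  obtain ⟨m, hm⟩ := exists_sphereMean_inner_pow (n := n) 3
  have key : ∀ a b : EuclideanSpace ℝ (Fin n),
      sphereMean n (fun x => ⟪a, x⟫ ^ 4 * ⟪b, x⟫ ^ 2)
        = m / 5 * (⟪a, a⟫ ^ 2 * ⟪b, b⟫ + 4 * ⟪a, a⟫ * ⟪a, b⟫ ^ 2) := by
    intro a b
    have h : (fun x : EuclideanSpace ℝ (Fin n) => ⟪a, x⟫ ^ 4 * ⟪b, x⟫ ^ 2) =
        fun x => ∑ i, ![-(1 / 360 : ℝ), -(1 / 360), 2 / 45, 2 / 45, -(1 / 12), 4 / 15] i *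
          ⟪![a + (2 : ℝ) • b, a - (2 : ℝ) • b, a + b, a - b, a, b] i, x⟫ ^ (2 * 3) := by
      funext x
      simp [Fin.sum_univ_succ, inner_add_left, inner_sub_left, inner_smul_left]
      ring
    rw [h, sphereMean_linearCombination _ _ fun i => by fun_prop]
    simp only [hm]
    simp [-inner_self_eq_norm_sq_to_K, Fin.sum_univ_succ, inner_add_left,
      inner_sub_left, inner_add_right, inner_sub_right,
      inner_smul_left, inner_smul_right, real_inner_comm a b]
    ring
  have hn : (n : ℝ) ≠ 0 := by exact_mod_cast NeZero.ne n
  have hn2 : (n : ℝ) + 2 ≠ 0 := by positivity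
  have hn4 : (n : ℝ) + 4 ≠ 0 := by positivity
  have hm6 : m = 15 / (n * (n + 2) * (n + 4)) := by
    have hs := sum_sphereMean_mul_single_sq (n := n)
      (F := fun x => ⟪EuclideanSpace.single (0 : Fin n) (1 : ℝ), x⟫ ^ 4) (by fun_prop)
    have h4 : sphereMean n (fun x => ⟪EuclideanSpace.single (0 : Fin n) (1 : ℝ), x⟫ ^ 4)
        = 3 / (n * (n + 2)) := by
      have := (sphereMean_quartic (EuclideanSpace.single (0 : Fin n) (1 : ℝ))
        (EuclideanSpace.single (0 : Fin n) (1 : ℝ))).2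
      simp only [← pow_succ'] at this
      rw [this]
      simp
    rw [h4] at hs
    simp only [key, ← Finset.mul_sum, Finset.sum_add_distrib] at hs
    have h2 : ∑ i, ⟪EuclideanSpace.single (0 : Fin n) (1 : ℝ), EuclideanSpace.single i (1 : ℝ)⟫ ^ 2
        = 1 := by
      simp only [real_inner_comm _ (EuclideanSpace.single (0 : Fin n) (1 : ℝ)),
        sum_inner_single_sq]
      simp
    rw [h2] at hs
    simp at hs
    field_simp at hs ⊢
    linear_combination hs
  have h : (fun x : EuclideanSpace ℝ (Fin n) => ⟪a, x⟫ ^ 3 * ⟪b, x⟫ ^ 3) =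
      fun x => ∑ i, ![-(13 / 960 : ℝ), 13 / 960, 1 / 120, -(1 / 120), -(1 / 960), 1 / 960] i *
        ⟪![a + b, a - b, a + (2 : ℝ) • b, a - (2 : ℝ) • b, a + (3 : ℝ) • b, a - (3 : ℝ) • b] i,
          x⟫ ^ (2 * 3) := by
    funext x
    simp [Fin.sum_univ_succ, inner_add_left, inner_sub_left, inner_smul_left]
    ring
  rw [h, sphereMean_linearCombination _ _ fun i => by fun_prop]
  simp only [hm]
  simp [-inner_self_eq_norm_sq_to_K, Fin.sum_univ_succ, inner_add_left,
      inner_sub_left, inner_add_right, inner_sub_right,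
    inner_smul_left, inner_smul_right, real_inner_comm a b, hm6]
  field_simp
  ring

/-- The mean of a product of two cubic zonal functions over the unit sphere. -/
theorem sphereMean_cubic_mul_cubic [NeZero n] (a b : EuclideanSpace ℝ (Fin n))
    (p₀ p₁ p₂ p₃ q₀ q₁ q₂ q₃ : ℝ) :
    sphereMean n (fun x => (p₀ + p₁ * ⟪a, x⟫ + p₂ * ⟪a, x⟫ ^ 2 + p₃ * ⟪a, x⟫ ^ 3) *
        (q₀ + q₁ * ⟪b, x⟫ + q₂ * ⟪b, x⟫ ^ 2 + q₃ * ⟪b, x⟫ ^ 3)) =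
      p₀ * q₀ + (p₀ * q₂ * ⟪b, b⟫ + p₂ * q₀ * ⟪a, a⟫ + p₁ * q₁ * ⟪a, b⟫) / n
      + (3 * p₁ * q₃ * ⟪b, b⟫ * ⟪a, b⟫ + 3 * p₃ * q₁ * ⟪a, a⟫ * ⟪a, b⟫
        + p₂ * q₂ * (⟪a, a⟫ * ⟪b, b⟫ + 2 * ⟪a, b⟫ ^ 2)) / (n * (n + 2))
      + p₃ * q₃ * (9 * ⟪a, a⟫ * ⟪b, b⟫ * ⟪a, b⟫ + 6 * ⟪a, b⟫ ^ 3) / (n * (n + 2) * (n + 4)) := by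
  set F : EuclideanSpace ℝ (Fin n) → ℝ := fun x =>
    (p₀ + p₁ * ⟪a, x⟫ + p₂ * ⟪a, x⟫ ^ 2 + p₃ * ⟪a, x⟫ ^ 3) *
        (q₀ + q₁ * ⟪b, x⟫ + q₂ * ⟪b, x⟫ ^ 2 + q₃ * ⟪b, x⟫ ^ 3) with hFdef
  have hF : Continuous F := by fun_prop
  have hneg := sphereMean_comp (LinearIsometryEquiv.neg ℝ) F
  have hadd := sphereMean_add (hF.comp (LinearIsometryEquiv.neg ℝ).continuous) hF
  have heven : (fun x => (F ∘ (LinearIsometryEquiv.neg ℝ)) x + F x) = fun x =>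
      ∑ i, ![2 * p₀ * q₀, 2 * p₀ * q₂, 2 * p₂ * q₀, 2 * p₁ * q₁, 2 * p₁ * q₃, 2 * p₃ * q₁,
        2 * p₂ * q₂, 2 * p₃ * q₃] i *
      (![fun _ => 1, fun x => ⟪b, x⟫ ^ 2, fun x => ⟪a, x⟫ ^ 2, fun x => ⟪a, x⟫ * ⟪b, x⟫,
        fun x => ⟪a, x⟫ * ⟪b, x⟫ ^ 3, fun x => ⟪b, x⟫ * ⟪a, x⟫ ^ 3,
        fun x => ⟪a, x⟫ ^ 2 * ⟪b, x⟫ ^ 2,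
        fun x => ⟪a, x⟫ ^ 3 * ⟪b, x⟫ ^ 3] : Fin 8 → EuclideanSpace ℝ (Fin n) → ℝ) i x := by
    funext x
    simp [Fin.sum_univ_succ, hFdef]
    ring
  rw [heven, sphereMean_linearCombination _ _ (by
    intro i; fin_cases i <;> simp <;> fun_prop)] at hadd
  simp [Fin.sum_univ_succ, sphereMean_const, sphereMean_inner_sq, sphereMean_inner_mul_inner,
    sphereMean_quartic, sphereMean_sextic] at hadd
  have hneg' : sphereMean n (F ∘ (LinearIsometryEquiv.neg ℝ)) = sphereMean n F := hneg
  simp only [real_inner_comm a b] at hadd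
  simp only [real_inner_self_eq_norm_sq]
  simp only [LinearIsometryEquiv.coe_neg] at hneg'
  linear_combination (norm := skip) -(1 / 2 : ℝ) * hadd - (1 / 2 : ℝ) * hneg'
  ring_nf

end SphereMean

section PolynomialFunctions

/-- `F` is given by a polynomial of total degree at most `d`. -/
def IsPolynomialFunction (n d : ℕ) (F : EuclideanSpace ℝ (Fin n) → ℝ) : Prop :=
  ∃ f : MvPolynomial (Fin n) ℝ, f.totalDegree ≤ d ∧
    ∀ x : EuclideanSpace ℝ (Fin n), eval (x : Fin n → ℝ) f = F x

namespace IsPolynomialFunction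

variable {n d e : ℕ} {F G : EuclideanSpace ℝ (Fin n) → ℝ}

theorem mono (h : d ≤ e) (hF : IsPolynomialFunction n d F) : IsPolynomialFunction n e F :=
  let ⟨f, hf, hfx⟩ := hF
  ⟨f, hf.trans h, hfx⟩

theorem const (c : ℝ) : IsPolynomialFunction n 0 fun _ => c :=
  ⟨C c, by simp, by simp⟩

theorem add (hF : IsPolynomialFunction n d F) (hG : IsPolynomialFunction n d G) :
    IsPolynomialFunction n d fun x => F x + G x := by
  obtain ⟨f, hf, hfx⟩ := hF
  obtain ⟨g, hg, hgx⟩ := hG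
  exact ⟨f + g, (totalDegree_add f g).trans (max_le hf hg), fun x => by simp [hfx, hgx]⟩

theorem mul (hF : IsPolynomialFunction n d F) (hG : IsPolynomialFunction n e G) :
    IsPolynomialFunction n (d + e) fun x => F x * G x := by
  obtain ⟨f, hf, hfx⟩ := hF
  obtain ⟨g, hg, hgx⟩ := hG
  exact ⟨f * g, (totalDegree_mul f g).trans (add_le_add hf hg), fun x => by simp [hfx, hgx]⟩

theorem inner (a : EuclideanSpace ℝ (Fin n)) : IsPolynomialFunction n 1 fun x => ⟪a, x⟫ := by
  refine ⟨∑ i, C (a i) * X i, ?_, fun x => ?_⟩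
  · refine totalDegree_finsetSum_le fun i _ => (totalDegree_mul _ _).trans ?_
    simp
  · simp [PiLp.inner_apply, mul_comm]

theorem inner_self : IsPolynomialFunction n 2 fun x => ⟪x, x⟫ := by
  refine ⟨∑ i, X i * X i, ?_, fun x => ?_⟩
  · refine totalDegree_finsetSum_le fun i _ => (totalDegree_mul _ _).trans ?_
    simp
  · simp [-inner_self_eq_norm_sq_to_K, PiLp.inner_apply]

end IsPolynomialFunction

end PolynomialFunctions

section ZonalKernel

/-- The zonal harmonic of degree `2` on `ℝ²²`, normalized to be reproducing on the unit sphere. -/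
noncomputable def zonalTwo (u x : EuclideanSpace ℝ (Fin 22)) : ℝ :=
  12 * (22 * ⟪u, x⟫ ^ 2 - ⟪u, u⟫ * ⟪x, x⟫)

/-- The zonal harmonic of degree `3` on `ℝ²²`, normalized to be reproducing on the unit sphere. -/
noncomputable def zonalThree (u x : EuclideanSpace ℝ (Fin 22)) : ℝ :=
  286 * (8 * ⟪u, x⟫ ^ 3 - ⟪u, u⟫ * ⟪x, x⟫ * ⟪u, x⟫)

/-- A combination of zonal harmonics of degree at most `3` in which those of degree at most `1`
carry the radial factor `α + β * ‖x‖²`. -/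
noncomputable def zonalKernel (c₂ c₃ α β γ : ℝ) (u x : EuclideanSpace ℝ (Fin 22)) : ℝ :=
  (α + β * ⟪x, x⟫) * (1 + γ * ⟪u, x⟫) + c₂ * zonalTwo u x + c₃ * zonalThree u x

theorem isPolynomialFunction_zonalKernel (c₂ c₃ α β γ : ℝ) (u : EuclideanSpace ℝ (Fin 22)) :
    IsPolynomialFunction 22 3 (zonalKernel c₂ c₃ α β γ u) := by
  have h1 := IsPolynomialFunction.inner u
  have hn := IsPolynomialFunction.inner_self (n := 22)
  have hc := fun c => IsPolynomialFunction.const (n := 22) c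
  have hcd := fun c => (hc c).mono (e := 2) (by norm_num)
  have e1 := ((hcd α).add ((hc β).mul hn)).mul
    (((hc 1).mono (e := 1) (by norm_num)).add ((hc γ).mul h1))
  have e2 := ((((hc (c₂ * 264)).mul (h1.mul h1)).add
    ((hc (-(c₂ * 12 * ⟪u, u⟫))).mul hn)).mono (e := 3) (by norm_num))
  have e3 := ((hc (c₃ * 2288)).mul ((h1.mul h1).mul h1)).add
    ((hc (-(c₃ * 286 * ⟪u, u⟫))).mul (hn.mul h1))
  obtain ⟨f, hf, hfx⟩ := (e1.add e2).add e3
  refine ⟨f, hf, fun x => ?_⟩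
  rw [hfx, zonalKernel, zonalTwo, zonalThree]
  ring

theorem sphereMean_zonalKernel_mul (c₂ c₃ α β γ α' β' γ' r : ℝ)
    (u v : EuclideanSpace ℝ (Fin 22)) :
    sphereMean 22 (fun x => zonalKernel c₂ c₃ α β γ u (r • x) *
        zonalKernel c₂ c₃ α' β' γ' v (r • x)) =
      (α + β * r ^ 2) * (α' + β' * r ^ 2) * (1 + γ * γ' * r ^ 2 * ⟪u, v⟫ / 22)
        + c₂ ^ 2 * r ^ 4 * zonalTwo u v + c₃ ^ 2 * r ^ 6 * zonalThree u v := by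
  have h := sphereMean_cubic_mul_cubic u v
    (α + β * r ^ 2 - 12 * c₂ * r ^ 2 * ⟪u, u⟫)
    ((α + β * r ^ 2) * γ * r - 286 * c₃ * r ^ 3 * ⟪u, u⟫) (264 * c₂ * r ^ 2) (2288 * c₃ * r ^ 3)
    (α' + β' * r ^ 2 - 12 * c₂ * r ^ 2 * ⟪v, v⟫)
    ((α' + β' * r ^ 2) * γ' * r - 286 * c₃ * r ^ 3 * ⟪v, v⟫) (264 * c₂ * r ^ 2)
    (2288 * c₃ * r ^ 3)
  refine (sphereMean_congr fun x hx => ?_).trans (h.trans ?_)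
  · have hxx : ⟪x, x⟫ = 1 := by rw [real_inner_self_eq_norm_sq, hx]; norm_num
    simp only [zonalKernel, zonalTwo, zonalThree, real_inner_smul_left, real_inner_smul_right, hxx]
    ring
  · simp only [zonalTwo, zonalThree]
    norm_num
    ring

end ZonalKernel

section Reproducing

/-- A reproducing kernel whose trace is the number of points is diagonal. -/
theorem eq_ite_of_reproducing {ι : Type*} [DecidableEq ι] {s : Finset ι} {w : ι → ℝ}
    {k : ι → ι → ℝ} (hw : ∀ u ∈ s, 0 < w u)
    (hrep : ∀ u ∈ s, ∑ x ∈ s, w x * (k u x * k u x) = k u u)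
    (htr : ∑ u ∈ s, w u * k u u = s.card) {u v : ι} (hu : u ∈ s) (hv : v ∈ s) :
    k u v = if u = v then 1 / w u else 0 := by
  have hrow : ∀ u ∈ s, ∑ x ∈ s, w u * w x * (k u x - if u = x then 1 / w u else 0) ^ 2
      = 1 - w u * k u u := by
    intro u hu
    have hwu := (hw u hu).ne'
    have hterm : ∀ x ∈ s, w u * w x * (k u x - if u = x then 1 / w u else 0) ^ 2
        = w u * (w x * (k u x * k u x)) + if u = x then 1 - 2 * (w u * k u u) else 0 := by
      intro x _
      split_ifs with h
      · subst h
        field_simp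
        ring
      · ring
    rw [Finset.sum_congr rfl hterm, Finset.sum_add_distrib, ← Finset.mul_sum, hrep u hu,
      Finset.sum_ite_eq, if_pos hu]
    ring
  have htot : ∑ u ∈ s, ∑ x ∈ s, w u * w x * (k u x - if u = x then 1 / w u else 0) ^ 2 = 0 := by
    rw [Finset.sum_congr rfl hrow, Finset.sum_sub_distrib, htr]
    simp
  have hnn : ∀ u ∈ s, ∀ x ∈ s, 0 ≤ w u * w x * (k u x - if u = x then 1 / w u else 0) ^ 2 :=
    fun u hu x hx => mul_nonneg (mul_nonneg (hw u hu).le (hw x hx).le) (sq_nonneg _)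
  have h1 := (Finset.sum_eq_zero_iff_of_nonneg fun u hu => Finset.sum_nonneg (hnn u hu)).1 htot u hu
  have h2 := (Finset.sum_eq_zero_iff_of_nonneg (hnn u hu)).1 h1 v hv
  have h3 := (mul_eq_zero.1 h2).resolve_left (mul_pos (hw u hu) (hw v hv)).ne'
  exact sub_eq_zero.1 (pow_eq_zero_iff two_ne_zero |>.1 h3)

end Reproducing

section TwoSphereDesign

variable {t : ℕ} {X₁ X₂ : Finset (EuclideanSpace ℝ (Fin 22))} {w : EuclideanSpace ℝ (Fin 22) → ℝ}
  {r₁ r₂ : ℝ}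

theorem disjoint_of_norm_eq (hrne : r₁ ≠ r₂) (hX₁ : ∀ x ∈ X₁, ‖x‖ = r₁)
    (hX₂ : ∀ x ∈ X₂, ‖x‖ = r₂) : Disjoint X₁ X₂ :=
  Finset.disjoint_left.2 fun x h1 h2 => hrne ((hX₁ x h1).symm.trans (hX₂ x h2))

theorem IsEuclideanDesignTwoSpheres.sum_eq (hdesign : IsEuclideanDesignTwoSpheres t X₁ X₂ w r₁ r₂)
    {F : EuclideanSpace ℝ (Fin 22) → ℝ} (hF : IsPolynomialFunction 22 t F) :
    ∑ x ∈ X₁ ∪ X₂, w x * F x = (∑ x ∈ X₁, w x) * sphereMean 22 (fun x => F (r₁ • x)) +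
      (∑ x ∈ X₂, w x) * sphereMean 22 (fun x => F (r₂ • x)) := by
  obtain ⟨f, hf, hfx⟩ := hF
  have havg : ∀ r, sphereAvg 22 r f = sphereMean 22 (fun x => F (r • x)) := by
    intro r
    unfold sphereAvg sphereMean
    congr 1
    funext u
    exact hfx (r • (u : EuclideanSpace ℝ (Fin 22)))
  rw [← havg, ← havg, hdesign f hf]
  exact Finset.sum_congr rfl fun x _ => by rw [hfx]

theorem IsEuclideanDesignTwoSpheres.sum_zonalKernel_mul
    (hdesign : IsEuclideanDesignTwoSpheres 6 X₁ X₂ w r₁ r₂) (c₂ c₃ α β γ α' β' γ' : ℝ)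
    (u v : EuclideanSpace ℝ (Fin 22)) :
    ∑ x ∈ X₁ ∪ X₂, w x * (zonalKernel c₂ c₃ α β γ u x * zonalKernel c₂ c₃ α' β' γ' v x) =
      (∑ x ∈ X₁, w x) * ((α + β * r₁ ^ 2) * (α' + β' * r₁ ^ 2) *
          (1 + γ * γ' * r₁ ^ 2 * ⟪u, v⟫ / 22)
        + c₂ ^ 2 * r₁ ^ 4 * zonalTwo u v + c₃ ^ 2 * r₁ ^ 6 * zonalThree u v) +
      (∑ x ∈ X₂, w x) * ((α + β * r₂ ^ 2) * (α' + β' * r₂ ^ 2) *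
          (1 + γ * γ' * r₂ ^ 2 * ⟪u, v⟫ / 22)
        + c₂ ^ 2 * r₂ ^ 4 * zonalTwo u v + c₃ ^ 2 * r₂ ^ 6 * zonalThree u v) := by
  rw [hdesign.sum_eq ((isPolynomialFunction_zonalKernel c₂ c₃ α β γ u).mul
    (isPolynomialFunction_zonalKernel c₂ c₃ α' β' γ' v)), sphereMean_zonalKernel_mul,
    sphereMean_zonalKernel_mul]

theorem sq_sub_sq_ne_zero (hr₁ : 0 < r₁) (hr₂ : 0 < r₂) (hrne : r₁ ≠ r₂) :
    r₁ ^ 2 - r₂ ^ 2 ≠ 0 := by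
  rw [sq_sub_sq]
  exact mul_ne_zero (by positivity) (sub_ne_zero.2 hrne)

/-- A tight `6`-design has constant weight on each fiber, and the inner products between the fibers
are roots of a common cubic. -/
theorem IsEuclideanDesignTwoSpheres.tight (hr₁ : 0 < r₁) (hr₂ : 0 < r₂) (hrne : r₁ ≠ r₂)
    (hX₁ : ∀ x ∈ X₁, ‖x‖ = r₁) (hX₂ : ∀ x ∈ X₂, ‖x‖ = r₂)
    (hw : ∀ x ∈ X₁ ∪ X₂, 0 < w x) (hcard : (X₁ ∪ X₂).card = 2300)
    (hne₁ : X₁.Nonempty) (hne₂ : X₂.Nonempty)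
    (hdesign : IsEuclideanDesignTwoSpheres 6 X₁ X₂ w r₁ r₂) :
    (∃ a, ∀ x ∈ X₁, w x = a) ∧ (∃ a, ∀ x ∈ X₂, w x = a) ∧
      ∃ c₂ c₃ : ℝ, 0 < c₂ ∧ 0 < c₃ ∧
        ∀ x ∈ X₁, ∀ y ∈ X₂, c₂ * zonalTwo x y + c₃ * zonalThree x y = 0 := by
  have hdisj := disjoint_of_norm_eq hrne hX₁ hX₂
  have hd : r₁ ^ 2 - r₂ ^ 2 ≠ 0 := sq_sub_sq_ne_zero hr₁ hr₂ hrne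
  have hn₁ : ∀ x ∈ X₁, ⟪x, x⟫ = r₁ ^ 2 := fun x hx => by
    rw [real_inner_self_eq_norm_sq, hX₁ x hx]
  have hn₂ : ∀ x ∈ X₂, ⟪x, x⟫ = r₂ ^ 2 := fun x hx => by
    rw [real_inner_self_eq_norm_sq, hX₂ x hx]
  have hnot : ∀ x ∈ X₂, x ∉ X₁ := fun x hx => Finset.disjoint_right.1 hdisj hx
  have hmul := hdesign.sum_zonalKernel_mul
  have hW₁ : 0 < ∑ x ∈ X₁, w x :=
    Finset.sum_pos (fun x hx => hw x (Finset.mem_union_left _ hx)) hne₁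
  have hW₂ : 0 < ∑ x ∈ X₂, w x :=
    Finset.sum_pos (fun x hx => hw x (Finset.mem_union_right _ hx)) hne₂
  have hsw₁ : ∀ c, ∑ x ∈ X₁, w x * c = (∑ x ∈ X₁, w x) * c := fun c => (Finset.sum_mul ..).symm
  have hsw₂ : ∀ c, ∑ x ∈ X₂, w x * c = (∑ x ∈ X₂, w x) * c := fun c => (Finset.sum_mul ..).symm
  generalize ∑ x ∈ X₁, w x = W₁ at *
  generalize ∑ x ∈ X₂, w x = W₂ at *
  have hD₂ : 0 < W₁ * r₁ ^ 4 + W₂ * r₂ ^ 4 := by positivity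
  have hD₃ : 0 < W₁ * r₁ ^ 6 + W₂ * r₂ ^ 6 := by positivity
  obtain ⟨D₂, hD₂e⟩ : ∃ D, D = W₁ * r₁ ^ 4 + W₂ * r₂ ^ 4 := ⟨_, rfl⟩
  obtain ⟨D₃, hD₃e⟩ : ∃ D, D = W₁ * r₁ ^ 6 + W₂ * r₂ ^ 6 := ⟨_, rfl⟩
  rw [← hD₂e] at hD₂
  rw [← hD₃e] at hD₃
  let k₁ := zonalKernel (1 / D₂) (1 / D₃) (-r₂ ^ 2 / (W₁ * (r₁ ^ 2 - r₂ ^ 2)))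
    (1 / (W₁ * (r₁ ^ 2 - r₂ ^ 2))) (22 / r₁ ^ 2)
  let k₂ := zonalKernel (1 / D₂) (1 / D₃) (r₁ ^ 2 / (W₂ * (r₁ ^ 2 - r₂ ^ 2)))
    (-1 / (W₂ * (r₁ ^ 2 - r₂ ^ 2))) (22 / r₂ ^ 2)
  let k : EuclideanSpace ℝ (Fin 22) → EuclideanSpace ℝ (Fin 22) → ℝ := fun u x =>
    if u ∈ X₁ then k₁ u x else k₂ u x
  have hα₁ : -r₂ ^ 2 / (W₁ * (r₁ ^ 2 - r₂ ^ 2)) + 1 / (W₁ * (r₁ ^ 2 - r₂ ^ 2)) * r₁ ^ 2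
      = 1 / W₁ := by field_simp; ring
  have hα₁' : -r₂ ^ 2 / (W₁ * (r₁ ^ 2 - r₂ ^ 2)) + 1 / (W₁ * (r₁ ^ 2 - r₂ ^ 2)) * r₂ ^ 2
      = 0 := by field_simp; ring
  have hα₂ : r₁ ^ 2 / (W₂ * (r₁ ^ 2 - r₂ ^ 2)) + -1 / (W₂ * (r₁ ^ 2 - r₂ ^ 2)) * r₁ ^ 2
      = 0 := by field_simp; ring
  have hα₂' : r₁ ^ 2 / (W₂ * (r₁ ^ 2 - r₂ ^ 2)) + -1 / (W₂ * (r₁ ^ 2 - r₂ ^ 2)) * r₂ ^ 2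
      = 1 / W₂ := by field_simp; ring
  have hk₁ : ∀ u ∈ X₁, k u = k₁ u := fun u hu => by simp only [k, if_pos hu]
  have hk₂ : ∀ u ∈ X₂, k u = k₂ u := fun u hu => by simp only [k, if_neg (hnot u hu)]
  have hdiag₁ : ∀ u ∈ X₁, k u u = 23 / W₁ + 252 * r₁ ^ 4 / D₂ + 2002 * r₁ ^ 6 / D₃ := by
    intro u hu
    rw [hk₁ u hu]
    simp only [k₁, zonalKernel, zonalTwo, zonalThree, hn₁ u hu, hα₁]
    field_simp
    ring
  have hdiag₂ : ∀ u ∈ X₂, k u u = 23 / W₂ + 252 * r₂ ^ 4 / D₂ + 2002 * r₂ ^ 6 / D₃ := by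
    intro u hu
    rw [hk₂ u hu]
    simp only [k₂, zonalKernel, zonalTwo, zonalThree, hn₂ u hu, hα₂']
    field_simp
    ring
  have hrep : ∀ u ∈ X₁ ∪ X₂, ∑ x ∈ X₁ ∪ X₂, w x * (k u x * k u x) = k u u := by
    intro u hu
    rcases Finset.mem_union.1 hu with hu | hu
    · rw [hdiag₁ u hu, hk₁ u hu]
      simp only [k₁, hmul, zonalTwo, zonalThree, hα₁, hα₁', hn₁ u hu]
      field_simp
      rw [hD₂e, hD₃e]
      ring
    · rw [hdiag₂ u hu, hk₂ u hu]
      simp only [k₂, hmul, zonalTwo, zonalThree, hα₂, hα₂', hn₂ u hu]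
      field_simp
      rw [hD₂e, hD₃e]
      ring
  have htr : ∑ u ∈ X₁ ∪ X₂, w u * k u u = (X₁ ∪ X₂).card := by
    rw [hcard, Finset.sum_union hdisj,
      Finset.sum_congr rfl fun u hu => congrArg (w u * ·) (hdiag₁ u hu),
      Finset.sum_congr rfl fun u hu => congrArg (w u * ·) (hdiag₂ u hu), hsw₁, hsw₂]
    field_simp
    rw [hD₂e, hD₃e]
    push_cast
    ring
  have hK : ∀ {u v}, u ∈ X₁ ∪ X₂ → v ∈ X₁ ∪ X₂ → k u v = if u = v then 1 / w u else 0 :=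
    fun hu hv => eq_ite_of_reproducing hw hrep htr hu hv
  have hweight : ∀ u ∈ X₁ ∪ X₂, w u = 1 / k u u := fun u hu => by
    rw [hK hu hu, if_pos rfl, one_div_one_div]
  refine ⟨⟨1 / (23 / W₁ + 252 * r₁ ^ 4 / D₂ + 2002 * r₁ ^ 6 / D₃), fun x hx => ?_⟩,
    ⟨1 / (23 / W₂ + 252 * r₂ ^ 4 / D₂ + 2002 * r₂ ^ 6 / D₃), fun x hx => ?_⟩,
    1 / D₂, 1 / D₃, by positivity, by positivity, fun x hx y hy => ?_⟩
  · rw [hweight x (Finset.mem_union_left _ hx), hdiag₁ x hx]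
  · rw [hweight x (Finset.mem_union_right _ hx), hdiag₂ x hx]
  · have h := hK (Finset.mem_union_left _ hx) (Finset.mem_union_right X₁ hy)
    rw [if_neg fun hxy : x = y => hnot y hy (hxy ▸ hx), hk₁ x hx] at h
    simp only [k₁, zonalKernel, hn₂ y hy, hα₁'] at h
    linarith

theorem sphereMean_christoffel (α β r s : ℝ) (b : EuclideanSpace ℝ (Fin 22)) :
    sphereMean 22 (fun x => (α + β * ⟪r • x, r • x⟫) *
      (1 + s * ⟪b, r • x⟫ + 4 / 7 * (s ^ 2 - 1) * (⟪b, r • x⟫ ^ 2 - 1))) =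
      (α + β * r ^ 2) * (1 + 4 / 7 * (s ^ 2 - 1) * (r ^ 2 * ⟪b, b⟫ / 22 - 1)) := by
  have h := sphereMean_cubic_mul_cubic b b (α + β * r ^ 2) 0 0 0
    (1 - 4 / 7 * (s ^ 2 - 1)) (s * r) (4 / 7 * (s ^ 2 - 1) * r ^ 2) 0
  refine (sphereMean_congr fun x hx => ?_).trans (h.trans ?_)
  · have hxx : ⟪x, x⟫ = 1 := by rw [real_inner_self_eq_norm_sq, hx]; norm_num
    simp only [real_inner_smul_left, real_inner_smul_right, hxx]
    ring
  · norm_num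
    ring

/-- A fiber of constant weight is a spherical `4`-design, tested on the Christoffel kernel of
degree `2`. -/
theorem IsEuclideanDesignTwoSpheres.sum_christoffel_eq_card
    (hr₁ : 0 < r₁) (hr₂ : 0 < r₂) (hrne : r₁ ≠ r₂)
    (hX₁ : ∀ x ∈ X₁, ‖x‖ = r₁) (hX₂ : ∀ x ∈ X₂, ‖x‖ = r₂)
    (hw : ∀ x ∈ X₁ ∪ X₂, 0 < w x) {a : ℝ} (ha : ∀ x ∈ X₁, w x = a)
    (hdesign : IsEuclideanDesignTwoSpheres 6 X₁ X₂ w r₁ r₂) (s : ℝ)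
    {b : EuclideanSpace ℝ (Fin 22)} (hb : r₁ ^ 2 * ⟪b, b⟫ = 22) :
    ∑ x ∈ X₁, (1 + s * ⟪b, x⟫ + 4 / 7 * (s ^ 2 - 1) * (⟪b, x⟫ ^ 2 - 1)) = (X₁.card : ℝ) := by
  rcases X₁.eq_empty_or_nonempty with rfl | ⟨x₀, hx₀⟩
  · simp
  have ha0 : 0 < a := (hw x₀ (Finset.mem_union_left _ hx₀)).trans_eq (ha x₀ hx₀)
  have hd : r₁ ^ 2 - r₂ ^ 2 ≠ 0 := sq_sub_sq_ne_zero hr₁ hr₂ hrne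
  have hF : IsPolynomialFunction 22 6 fun x =>
      (-r₂ ^ 2 / (r₁ ^ 2 - r₂ ^ 2) + 1 / (r₁ ^ 2 - r₂ ^ 2) * ⟪x, x⟫) *
        (1 + s * ⟪b, x⟫ + 4 / 7 * (s ^ 2 - 1) * (⟪b, x⟫ ^ 2 - 1)) := by
    have h1 := IsPolynomialFunction.inner b
    have hn := IsPolynomialFunction.inner_self (n := 22)
    have hc := fun c => IsPolynomialFunction.const (n := 22) c
    have hcd := fun c => (hc c).mono (e := 2) (by norm_num)
    obtain ⟨f, hf, hfx⟩ := (((hcd (-r₂ ^ 2 / (r₁ ^ 2 - r₂ ^ 2))).add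
      ((hc (1 / (r₁ ^ 2 - r₂ ^ 2))).mul hn |>.mono (e := 2) (by norm_num))).mul
      (((hcd (1 - 4 / 7 * (s ^ 2 - 1))).add (((hc s).mul h1).mono (by norm_num))).add
        (((hc (4 / 7 * (s ^ 2 - 1))).mul (h1.mul h1)).mono (by norm_num)))).mono
          (e := 6) (by norm_num)
    refine ⟨f, hf, fun x => ?_⟩
    rw [hfx]
    ring
  have h := hdesign.sum_eq hF
  have hα₁ : -r₂ ^ 2 / (r₁ ^ 2 - r₂ ^ 2) + 1 / (r₁ ^ 2 - r₂ ^ 2) * r₁ ^ 2 = 1 := by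
    field_simp
    ring
  have hα₂ : -r₂ ^ 2 / (r₁ ^ 2 - r₂ ^ 2) + 1 / (r₁ ^ 2 - r₂ ^ 2) * r₂ ^ 2 = 0 := by
    field_simp
    ring
  have h₁ : ∀ x ∈ X₁, w x * ((-r₂ ^ 2 / (r₁ ^ 2 - r₂ ^ 2) + 1 / (r₁ ^ 2 - r₂ ^ 2) * ⟪x, x⟫) *
        (1 + s * ⟪b, x⟫ + 4 / 7 * (s ^ 2 - 1) * (⟪b, x⟫ ^ 2 - 1)))
      = a * (1 + s * ⟪b, x⟫ + 4 / 7 * (s ^ 2 - 1) * (⟪b, x⟫ ^ 2 - 1)) := fun x hx => by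
    rw [ha x hx, real_inner_self_eq_norm_sq, hX₁ x hx, hα₁, one_mul]
  have h₂ : ∀ x ∈ X₂, w x * ((-r₂ ^ 2 / (r₁ ^ 2 - r₂ ^ 2) + 1 / (r₁ ^ 2 - r₂ ^ 2) * ⟪x, x⟫) *
        (1 + s * ⟪b, x⟫ + 4 / 7 * (s ^ 2 - 1) * (⟪b, x⟫ ^ 2 - 1))) = 0 := fun x hx => by
    rw [real_inner_self_eq_norm_sq, hX₂ x hx, hα₂, zero_mul, mul_zero]
  rw [sphereMean_christoffel, sphereMean_christoffel, hα₁, hα₂, hb,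
    Finset.sum_union (disjoint_of_norm_eq hrne hX₁ hX₂), Finset.sum_congr rfl h₁,
    Finset.sum_eq_zero h₂, ← Finset.mul_sum, Finset.sum_congr rfl ha, Finset.sum_const,
    nsmul_eq_mul] at h
  refine mul_left_cancel₀ ha0.ne' ?_
  linarith

theorem IsEuclideanDesignTwoSpheres.symm (hdesign : IsEuclideanDesignTwoSpheres t X₁ X₂ w r₁ r₂) :
    IsEuclideanDesignTwoSpheres t X₂ X₁ w r₂ r₁ := fun f hf => by
  rw [add_comm, Finset.union_comm, hdesign f hf]

end TwoSphereDesign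

section ThreeValues

theorem le_of_sq_eq_seven_mul {k : ℕ} {q : ℝ} (hk : 1 ≤ k) (hk' : k ≤ 15)
    (hq : q ^ 2 = 7 * k * (16 - k)) (hq' : -(k : ℝ) / 5 ≤ q) :
    10 + 3 / 2 * ((min (k - 1) (15 - k) : ℕ) : ℝ) ≤ q := by
  have h0 : 0 ≤ q := by
    by_contra! h
    have h1 : (1 : ℝ) ≤ k := by exact_mod_cast hk
    have h2 : (k : ℝ) ≤ 15 := by exact_mod_cast hk'
    nlinarith
  refine le_of_sq_le_sq ?_ h0
  rw [hq]
  interval_cases k <;> norm_num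

/-- A three-atom system of multiplicities constrained as below has an atom of multiplicity `16`. -/
theorem exists_eq_sixteen {V : Finset ℝ} {k : ℝ → ℕ} (hV : V.card ≤ 3)
    (hk : ∀ v ∈ V, 1 ≤ k v) (hkv : ∀ v ∈ V, (k v : ℝ) * (4 * v ^ 4 - v ^ 2 + 11) = 175)
    (hsum : ∑ v ∈ V, k v = 25) (hsq : ∑ v ∈ V, (k v : ℝ) * v ^ 2 = 25) :
    V.card = 3 ∧ ∃ v ∈ V, k v = 16 := by
  let q : ℝ → ℝ := fun v => k v * (8 * v ^ 2 - 1) / 5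
  have hq : ∀ v ∈ V, q v ^ 2 = 7 * k v * (16 - k v) := fun v hv => by
    simp only [q]
    linear_combination (16 / 25 * k v : ℝ) * hkv v hv
  have hq' : ∀ v ∈ V, -(k v : ℝ) / 5 ≤ q v := fun v hv => by
    simp only [q]
    have : (0 : ℝ) ≤ k v * v ^ 2 := by positivity
    linarith
  have hle : ∀ v ∈ V, k v ≤ 16 := fun v hv => by
    by_contra! h
    have h1 : (17 : ℝ) ≤ k v := by exact_mod_cast h
    nlinarith [hq v hv, sq_nonneg (q v)]
  have hqsum : ∑ v ∈ V, q v = 35 := by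
    have hcast : ∑ v ∈ V, (k v : ℝ) = 25 := by exact_mod_cast hsum
    have : ∀ v ∈ V, q v = 8 / 5 * (k v * v ^ 2) - 1 / 5 * k v := fun v _ => by
      simp only [q]; ring
    rw [Finset.sum_congr rfl this, Finset.sum_sub_distrib, ← Finset.mul_sum, ← Finset.mul_sum,
      hsq, hcast]
    norm_num
  have hbound : ∀ v ∈ V, k v ≠ 16 →
      10 + 3 / 2 * ((min (k v - 1) (15 - k v) : ℕ) : ℝ) ≤ q v := fun v hv h =>
    le_of_sq_eq_seven_mul (hk v hv) (by have := hle v hv; omega) (hq v hv) (hq' v hv)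
  have hcard : V.card = 0 ∨ V.card = 1 ∨ V.card = 2 ∨ V.card = 3 := by omega
  rcases hcard with h | h | h | h
  · rw [Finset.card_eq_zero] at h
    simp [h] at hsum
  · obtain ⟨a, rfl⟩ := Finset.card_eq_one.1 h
    have := hle a (by simp)
    simp at hsum
    omega
  · exfalso
    obtain ⟨a, b, hab, rfl⟩ := Finset.card_eq_two.1 h
    rw [Finset.sum_pair hab] at hsum hqsum
    have ha := hle a (by simp)
    have hb := hle b (by simp)
    have hqa := hq a (by simp)
    have hqb := hq b (by simp)
    have hkb : k b = 25 - k a := by omega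
    have h9 : 9 ≤ k a := by omega
    rw [hkb] at hqb
    generalize k a = m at *
    have := sq_nonneg (q a - q b)
    have h35 : (q a + q b) ^ 2 = 1225 := by rw [hqsum]; norm_num
    interval_cases m <;> norm_num at hqa hqb <;> nlinarith
  · refine ⟨h, ?_⟩
    by_contra! hne
    obtain ⟨a, b, c, hab, hac, hbc, rfl⟩ := Finset.card_eq_three.1 h
    rw [Finset.sum_insert (by simp [hab, hac]), Finset.sum_pair hbc] at hsum hqsum
    have h4 : 4 ≤ min (k a - 1) (15 - k a) + (min (k b - 1) (15 - k b) +
        min (k c - 1) (15 - k c)) := by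
      have := hle a (by simp)
      have := hle b (by simp)
      have := hle c (by simp)
      have := hne a (by simp)
      have := hne b (by simp)
      have := hne c (by simp)
      have := hk a (by simp)
      have := hk b (by simp)
      have := hk c (by simp)
      omega
    have h4' : (4 : ℝ) ≤ ((min (k a - 1) (15 - k a) : ℕ) : ℝ) +
        (((min (k b - 1) (15 - k b) : ℕ) : ℝ) + ((min (k c - 1) (15 - k c) : ℕ) : ℝ)) := by
      exact_mod_cast h4
    linarith [hbound a (by simp) (hne a (by simp)), hbound b (by simp) (hne b (by simp)),
      hbound c (by simp) (hne c (by simp))]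

theorem finset_card_le_three_of_cubic {V : Finset ℝ} {b c d : ℝ}
    (hV : ∀ v ∈ V, v ^ 3 + b * v ^ 2 + c * v + d = 0) : V.card ≤ 3 := by
  let p : Cubic ℝ := ⟨1, b, c, d⟩
  have hp : p.toPoly ≠ 0 := Cubic.ne_zero_of_a_ne_zero one_ne_zero
  have hsub : V ⊆ p.toPoly.roots.toFinset := fun v hv => by
    rw [Multiset.mem_toFinset, Polynomial.mem_roots hp, Polynomial.IsRoot]
    simp [Cubic.toPoly, p, hV v hv]
  calc V.card ≤ p.toPoly.roots.toFinset.card := Finset.card_le_card hsub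
    _ ≤ p.toPoly.roots.card := Multiset.toFinset_card_le _
    _ ≤ p.toPoly.natDegree := Polynomial.card_roots' _
    _ ≤ 3 := Cubic.natDegree_of_a_ne_zero (P := p) one_ne_zero |>.le

/-- Two distinct roots of the cubic `X (X² - 11/4) + c (X² - 1)` are orthogonal with respect to
the Christoffel kernel of degree `2`. -/
theorem christoffel_eq_zero {c s t : ℝ} (hs : s * (s ^ 2 - 11 / 4) = -(c * (s ^ 2 - 1)))
    (ht : t * (t ^ 2 - 11 / 4) = -(c * (t ^ 2 - 1))) (hst : s ≠ t) :
    1 + s * t + 4 / 7 * (s ^ 2 - 1) * (t ^ 2 - 1) = 0 := by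
  have h := sub_ne_zero.2 hst
  apply mul_left_cancel₀ h
  linear_combination (4 / 7 * (t ^ 2 - 1)) * hs - (4 / 7 * (s ^ 2 - 1)) * ht

theorem card_filter_mul_christoffel {α : Type*} {X : Finset α} {t : α → ℝ} {c N s : ℝ}
    (hroot : ∀ x ∈ X, t x * (t x ^ 2 - 11 / 4) = -(c * (t x ^ 2 - 1)))
    (hsum : ∑ x ∈ X, (1 + s * t x + 4 / 7 * (s ^ 2 - 1) * (t x ^ 2 - 1)) = N)
    (hs : s * (s ^ 2 - 11 / 4) = -(c * (s ^ 2 - 1))) :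
    ((X.filter fun x => t x = s).card : ℝ) * (1 + s * s + 4 / 7 * (s ^ 2 - 1) * (s ^ 2 - 1))
      = N := by
  rw [← hsum, ← nsmul_eq_mul, ← Finset.sum_const, Finset.sum_filter]
  refine Finset.sum_congr rfl fun x hx => ?_
  split_ifs with h
  · rw [h]
  · exact (christoffel_eq_zero hs (hroot x hx) (Ne.symm h)).symm

theorem values_eq {α β : Type*} {X₁ : Finset α} {X₂ : Finset β} {t : α → β → ℝ} {c : ℝ}
    (hc : 0 < c) (hne : X₂.Nonempty) (hcard : X₁.card = 275)
    (hroot : ∀ x ∈ X₁, ∀ y ∈ X₂, t x y * (t x y ^ 2 - 11 / 4) = -(c * (t x y ^ 2 - 1)))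
    (hsum₁ : ∀ y ∈ X₂, ∀ s,
      ∑ x ∈ X₁, (1 + s * t x y + 4 / 7 * (s ^ 2 - 1) * (t x y ^ 2 - 1)) = 275)
    (hsum₂ : ∀ x ∈ X₁, ∀ s,
      ∑ y ∈ X₂, (1 + s * t x y + 4 / 7 * (s ^ 2 - 1) * (t x y ^ 2 - 1)) = 2025) :
    {a : ℝ | ∃ x ∈ X₁, ∃ y ∈ X₂, t x y = a} = {√2, -(√2 / 4), -(3 * √2 / 2)} := by
  obtain ⟨y₀, hy₀⟩ := hne
  let V : Finset ℝ := X₁.image fun x => t x y₀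
  let N : ℝ → ℕ := fun v => (X₁.filter fun x => t x y₀ = v).card
  have hrootV : ∀ v ∈ V, v * (v ^ 2 - 11 / 4) = -(c * (v ^ 2 - 1)) := by
    intro v hv
    obtain ⟨x, hx, rfl⟩ := Finset.mem_image.1 hv
    exact hroot x hx y₀ hy₀
  have hN : ∀ v ∈ V, (N v : ℝ) * (1 + v * v + 4 / 7 * (v ^ 2 - 1) * (v ^ 2 - 1)) = 275 :=
    fun v hv => card_filter_mul_christoffel (fun x hx => hroot x hx y₀ hy₀) (hsum₁ y₀ hy₀ v)
      (hrootV v hv)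
  have hdvd : ∀ v ∈ V, 11 ∣ N v := by
    intro v hv
    obtain ⟨x, hx, hxv⟩ := Finset.mem_image.1 hv
    have hM := card_filter_mul_christoffel (fun y hy => hroot x hx y hy) (hsum₂ x hx v)
      (hrootV v hv)
    have h1 := hN v hv
    have hpos : 0 < 1 + v * v + 4 / 7 * (v ^ 2 - 1) * (v ^ 2 - 1) := by
      nlinarith [sq_nonneg (v ^ 2 - 1)]
    have h2 : (81 * N v : ℝ) = 11 * (X₂.filter fun y => t x y = v).card := by
      apply mul_right_cancel₀ hpos.ne'
      linear_combination 81 * h1 - 11 * hM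
    have h3 : 81 * N v = 11 * (X₂.filter fun y => t x y = v).card := by exact_mod_cast h2
    omega
  let k : ℝ → ℕ := fun v => N v / 11
  have hkN : ∀ v ∈ V, (N v : ℝ) = 11 * k v := fun v hv => by
    exact_mod_cast (Nat.mul_div_cancel' (hdvd v hv)).symm
  have hmaps : ∀ x ∈ X₁, t x y₀ ∈ V := fun x hx => Finset.mem_image_of_mem _ hx
  have hsumN : ∑ v ∈ V, N v = 275 := by
    rw [← hcard, Finset.card_eq_sum_card_fiberwise hmaps]
  have hsqN : ∑ v ∈ V, (N v : ℝ) * v ^ 2 = 275 := by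
    have h1 : ∑ x ∈ X₁, t x y₀ ^ 2 = 275 := by
      have h0 := hsum₁ y₀ hy₀ 0
      simp only [zero_mul, add_zero, Finset.sum_add_distrib, ← Finset.mul_sum,
        Finset.sum_sub_distrib, Finset.sum_const, hcard] at h0
      norm_num at h0
      linarith
    rw [← h1, ← Finset.sum_fiberwise_of_maps_to hmaps]
    refine Finset.sum_congr rfl fun v _ => ?_
    rw [← nsmul_eq_mul, ← Finset.sum_const]
    exact Finset.sum_congr rfl fun x hx => by rw [(Finset.mem_filter.1 hx).2]
  have hV3 : V.card ≤ 3 := finset_card_le_three_of_cubic (b := c) (c := -(11 / 4)) (d := -c)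
    fun v hv => by linear_combination hrootV v hv
  obtain ⟨hV, v, hv, hkv⟩ := exists_eq_sixteen (k := k) hV3
    (fun v hv => by
      by_contra! h
      have h0 : k v = 0 := by omega
      have h1 := hN v hv
      rw [hkN v hv, h0] at h1
      norm_num at h1)
    (fun v hv => by
      have h1 := hN v hv
      rw [hkN v hv] at h1
      linear_combination 7 / 11 * h1)
    (by
      have h1 : ∑ v ∈ V, N v = ∑ v ∈ V, 11 * k v :=
        Finset.sum_congr rfl fun v hv => by exact_mod_cast hkN v hv
      rw [hsumN, ← Finset.mul_sum] at h1
      omega)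
    (by
      have h1 : ∑ v ∈ V, (N v : ℝ) * v ^ 2 = ∑ v ∈ V, 11 * ((k v : ℝ) * v ^ 2) :=
        Finset.sum_congr rfl fun v hv => by rw [hkN v hv]; ring
      rw [hsqN, ← Finset.mul_sum] at h1
      linarith)
  have hv2 : v ^ 2 = 1 / 8 := by
    have h1 := hN v hv
    rw [hkN v hv, hkv] at h1
    have h2 : (v ^ 2 - 1 / 8) ^ 2 = 0 := by
      push_cast at h1
      linear_combination 7 / (4 * 176) * h1
    have := pow_eq_zero_iff (two_ne_zero) |>.1 h2
    linarith
  have hcv : c = -3 * v := by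
    have h1 := hrootV v hv
    rw [hv2] at h1
    linarith
  have h2 : √2 ^ 2 = 2 := Real.sq_sqrt (by norm_num)
  have h2pos : 0 < √2 := by positivity
  have hv' : v = -(√2 / 4) := by
    have : (v - √2 / 4) * (v + √2 / 4) = 0 := by linear_combination hv2 - h2 / 16
    rcases mul_eq_zero.1 this with h | h <;> linarith
  have hsub : ∀ a, a * (a ^ 2 - 11 / 4) = -(c * (a ^ 2 - 1)) →
      a = √2 ∨ a = -(√2 / 4) ∨ a = -(3 * √2 / 2) := by
    intro a ha
    rw [hcv, hv'] at ha
    have : (a - √2) * ((a + √2 / 4) * (a + 3 * √2 / 2)) = 0 := by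
      linear_combination ha - (11 / 8 * a + 3 / 8 * √2) * h2
    rcases mul_eq_zero.1 this with h | h
    · exact Or.inl (by linarith)
    rcases mul_eq_zero.1 h with h | h
    · exact Or.inr (Or.inl (by linarith))
    · exact Or.inr (Or.inr (by linarith))
  have hVR : V = {√2, -(√2 / 4), -(3 * √2 / 2)} := by
    refine Finset.eq_of_subset_of_card_le (fun a ha => ?_) (by rw [hV]; exact Finset.card_le_three)
    simpa using hsub a (hrootV a ha)
  ext a
  constructor
  · rintro ⟨x, hx, y, hy, rfl⟩
    simpa using hsub _ (hroot x hx y hy)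
  · intro ha
    have : a ∈ V := by
      rw [hVR]
      simpa using ha
    obtain ⟨x, hx, hxa⟩ := Finset.mem_image.1 this
    exact ⟨x, hx, y₀, hy₀, hxa⟩

end ThreeValues

/-- the normalized inner products between points of `X₁` and points of `X₂`
form the set `{1/√11, -1/(4√11), -3/(2√11)}`. -/
theorem statement4
    {X₁ X₂ : Finset (EuclideanSpace ℝ (Fin 22))} {w : EuclideanSpace ℝ (Fin 22) → ℝ}
    {r₁ r₂ : ℝ} (hr₁ : 0 < r₁) (hr₂ : 0 < r₂) (hrne : r₁ ≠ r₂)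
    (hX₁ : ∀ x ∈ X₁, ‖x‖ = r₁) (hX₂ : ∀ x ∈ X₂, ‖x‖ = r₂)
    (hw : ∀ x ∈ X₁ ∪ X₂, 0 < w x)
    (hcard : (X₁ ∪ X₂).card = 2300) (hcard₁ : X₁.card = 275)
    (hdesign : IsEuclideanDesignTwoSpheres 6 X₁ X₂ w r₁ r₂) :
    {a : ℝ | ∃ x ∈ X₁, ∃ y ∈ X₂, ⟪x, y⟫ / (r₁ * r₂) = a}
      = {1 / Real.sqrt 11, -(1 / (4 * Real.sqrt 11)), -(3 / (2 * Real.sqrt 11))} := by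
  have hdisj := disjoint_of_norm_eq hrne hX₁ hX₂
  have hcard₂ : X₂.card = 2025 := by
    rw [Finset.card_union_of_disjoint hdisj] at hcard
    omega
  have hne₁ : X₁.Nonempty := Finset.card_pos.1 (by omega)
  have hne₂ : X₂.Nonempty := Finset.card_pos.1 (by omega)
  obtain ⟨⟨a₁, ha₁⟩, ⟨a₂, ha₂⟩, c₂, c₃, hc₂, hc₃, hcubic⟩ :=
    hdesign.tight hr₁ hr₂ hrne hX₁ hX₂ hw hcard hne₁ hne₂
  have hs : √22 ^ 2 = (22 : ℝ) := Real.sq_sqrt (by norm_num)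
  have hs0 : 0 < √(22 : ℝ) := Real.sqrt_pos.2 (by norm_num)
  have key := values_eq (X₁ := X₁) (X₂ := X₂) (t := fun x y => √22 * ⟪x, y⟫ / (r₁ * r₂))
    (c := 3 * √22 * c₂ / (26 * c₃ * r₁ * r₂)) (by positivity) hne₂ hcard₁
    (fun x hx y hy => ?_) (fun y hy s => ?_) (fun x hx s => ?_)
  · have h2 : √(2 : ℝ) = √22 * (1 / √11) := by
      rw [show (22 : ℝ) = 2 * 11 by norm_num, Real.sqrt_mul (by norm_num)]
      field_simp
    have hset : {a : ℝ | ∃ x ∈ X₁, ∃ y ∈ X₂, ⟪x, y⟫ / (r₁ * r₂) = a} =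
        (fun a => √22 * a) ⁻¹' {√2, -(√2 / 4), -(3 * √2 / 2)} := by
      rw [← key]
      ext a
      simp only [Set.mem_ofPred_eq, Set.mem_preimage, mul_div_assoc, mul_right_inj' hs0.ne']
    have e1 : -(√2 / 4) = √22 * (-(1 / (4 * √11))) := by
      rw [h2]
      field_simp
    have e2 : -(3 * √2 / 2) = √22 * (-(3 / (2 * √11))) := by
      rw [h2]
      field_simp
    rw [hset, e1, e2, h2]
    ext a
    simp only [Set.mem_preimage, Set.mem_insert_iff, Set.mem_singleton_iff, mul_right_inj' hs0.ne']
  · have h := hcubic x hx y hy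
    simp only [zonalTwo, zonalThree, real_inner_self_eq_norm_sq, hX₁ x hx, hX₂ y hy] at h
    obtain ⟨p, hp⟩ : ∃ p, p = √22 * ⟪x, y⟫ / (r₁ * r₂) := ⟨_, rfl⟩
    have hxy : ⟪x, y⟫ = √22 * (p * (r₁ * r₂)) / 22 := by
      rw [hp]
      field_simp
      rw [hs]
    rw [hxy] at h
    rw [← hp]
    obtain ⟨c, hc⟩ : ∃ c, c = 3 * √22 * c₂ / (26 * c₃ * r₁ * r₂) := ⟨_, rfl⟩
    rw [← hc]
    have hc' : c * (26 * c₃ * r₁ * r₂) = 3 * √22 * c₂ := by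
      rw [hc]
      field_simp
    have hpos : 0 < 52 / 11 * √22 * c₃ * (r₁ * r₂) ^ 3 := by positivity
    refine mul_left_cancel₀ hpos.ne' ?_
    linear_combination h - (6 / 11 * c₂ * (r₁ * r₂) ^ 2
      + 26 / 121 * c₃ * √22 * p ^ 3 * (r₁ * r₂) ^ 3) * hs
      + 2 / 11 * √22 * (r₁ * r₂) ^ 2 * (p ^ 2 - 1) * hc'
  · have hb : r₁ ^ 2 * ⟪(√22 / (r₁ * r₂)) • y, (√22 / (r₁ * r₂)) • y⟫ = 22 := by
      rw [real_inner_smul_left, real_inner_smul_right, real_inner_self_eq_norm_sq, hX₂ y hy]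
      field_simp
      exact hs
    have h := hdesign.sum_christoffel_eq_card hr₁ hr₂ hrne hX₁ hX₂ hw ha₁ s hb
    rw [hcard₁] at h
    push_cast at h
    refine Eq.trans ?_ h
    refine Finset.sum_congr rfl fun x _ => ?_
    rw [real_inner_smul_left, real_inner_comm x y, mul_div_right_comm]
  · have hb : r₂ ^ 2 * ⟪(√22 / (r₁ * r₂)) • x, (√22 / (r₁ * r₂)) • x⟫ = 22 := by
      rw [real_inner_smul_left, real_inner_smul_right, real_inner_self_eq_norm_sq, hX₁ x hx]
      field_simp
      exact hs
    have h := hdesign.symm.sum_christoffel_eq_card hr₂ hr₁ hrne.symm hX₂ hX₁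
      (by rwa [Finset.union_comm]) ha₂ s hb
    rw [hcard₂] at h
    push_cast at h
    refine Eq.trans ?_ h
    refine Finset.sum_congr rfl fun y _ => ?_
    rw [real_inner_smul_left, mul_div_right_comm]
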